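/- Let 𝐅 ∈ Λ'_{q,l} for some q>1 and integer l≥0, set F = ω^{-1}𝐅, and let p(z̄) be an anti-analytic polynomial. Suppose the infinite matrices 𝔓(F) and 𝔎(F) have rank at most N. Then the distribution 𝐆 = p(z̄)𝐅 belongs to Λ'_{q',l} for every q'<q, and the infinite matrices 𝔓(G) and 𝔎(G), where G = ω^{-1}𝐆 = p(z̄)F, have rank at most N. -/

import Mathlib

open MeasureTheory Filter Complex Metric

noncomputable section

/-- The Gaussian weight `ω(z) = π⁻¹ exp (-|z|²)`. -/
def omegaW (z : ℂ) : ℝ := Real.pi⁻¹ * Real.exp (-‖z‖ ^ 2)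

/-- Membership in the weighted space `Λ_{q,l}`: `C^l`-smooth functions whose
derivatives up to order `l` are `o(exp (q|z|²))` at infinity. -/
def MemLambda (q : ℝ) (l : ℕ) (ψ : ℂ → ℂ) : Prop :=
  ContDiff ℝ (l : ℕ∞) ψ ∧
    ∀ n : ℕ, n ≤ l →
      Tendsto (fun z : ℂ => ‖iteratedFDeriv ℝ n ψ z‖ * Real.exp (-q * ‖z‖ ^ 2))
        (cocompact ℂ) (nhds 0)

/-- The norm of `Λ_{q,l}`. -/
def lambdaNorm (q : ℝ) (l : ℕ) (ψ : ℂ → ℂ) : ℝ :=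
  sSup {r : ℝ | ∃ n ≤ l, ∃ z : ℂ, r = ‖iteratedFDeriv ℝ n ψ z‖ * Real.exp (-q * ‖z‖ ^ 2)}

/-- Distributions on `ℂ`, encoded by their pairing against test functions
(with respect to Lebesgue measure). -/
abbrev Dst : Type := (ℂ → ℂ) → ℂ

/-- Membership in the dual space `Λ'_{q,l}`. -/
def MemLambdaDual (q : ℝ) (l : ℕ) (T : Dst) : Prop :=
  (∀ ψ φ, MemLambda q l ψ → MemLambda q l φ → T (ψ + φ) = T ψ + T φ) ∧
  (∀ (c : ℂ) (ψ), MemLambda q l ψ → T (c • ψ) = c * T ψ) ∧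
  (∃ C : ℝ, ∀ ψ, MemLambda q l ψ → ‖T ψ‖ ≤ C * lambdaNorm q l ψ)

/-- The dual norm on `Λ'_{q,l}`. -/
def lambdaDualNorm (q : ℝ) (l : ℕ) (T : Dst) : ℝ :=
  sInf {C : ℝ | 0 ≤ C ∧ ∀ ψ, MemLambda q l ψ → ‖T ψ‖ ≤ C * lambdaNorm q l ψ}

/-- `∂̄ = (∂/∂x + i ∂/∂y)/2` of a function. -/
def dbarFun (ψ : ℂ → ℂ) : ℂ → ℂ := fun z =>
  (fderiv ℝ ψ z 1 + Complex.I * fderiv ℝ ψ z Complex.I) / 2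

/-- Membership in `𝔇_q`: smooth functions all of whose derivatives are
`o(exp (q|z|²))`. -/
def MemDq (q : ℝ) (ψ : ℂ → ℂ) : Prop :=
  ContDiff ℝ (⊤ : ℕ∞) ψ ∧
    ∀ n : ℕ,
      Tendsto (fun z : ℂ => ‖iteratedFDeriv ℝ n ψ z‖ * Real.exp (-q * ‖z‖ ^ 2))
        (cocompact ℂ) (nhds 0)

/-- Membership in the dual space `𝔇'_q`; every such distribution has finite
order, i.e. is bounded by some `Λ_{q,l}`-norm. -/
def MemDqDual (q : ℝ) (T : Dst) : Prop :=
  (∀ ψ φ, MemDq q ψ → MemDq q φ → T (ψ + φ) = T ψ + T φ) ∧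
  (∀ (c : ℂ) (ψ), MemDq q ψ → T (c • ψ) = c * T ψ) ∧
  (∃ (l : ℕ) (C : ℝ), ∀ ψ, MemDq q ψ → ‖T ψ‖ ≤ C * lambdaNorm q l ψ)

/-- Membership in the Fock space `𝓑`: entire and square integrable against `ω dλ`. -/
def MemFock (u : ℂ → ℂ) : Prop :=
  Differentiable ℂ u ∧ Integrable (fun z : ℂ => ‖u z‖ ^ 2 * omegaW z)

/-- The Fock norm. -/
def fockNorm (u : ℂ → ℂ) : ℝ := Real.sqrt (∫ z : ℂ, ‖u z‖ ^ 2 * omegaW z)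

/-- The Fock (weighted `L²`) inner product `(u,v) = ∫ u v̄ ω dλ`. -/
def fockInner (u v : ℂ → ℂ) : ℂ := ∫ z : ℂ, u z * (starRingEnd ℂ) (v z) * (omegaW z : ℂ)

/-- The reproducing kernel `κ_z(w) = exp (w z̄)`. -/
def repKer (z : ℂ) : ℂ → ℂ := fun w => Complex.exp (w * (starRingEnd ℂ) z)

/-- The Toeplitz sesquilinear form `𝐭_F(u,v) = ⟨ωF, u v̄⟩`, expressed through the
distribution `T = 𝐅 = ωF`. -/
def toeplitzForm (T : Dst) (u v : ℂ → ℂ) : ℂ := T fun z => u z * (starRingEnd ℂ) (v z)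

/-- An infinite matrix has rank at most `N` iff every finite submatrix does. -/
def InfRankLE (A : ℕ → ℕ → ℂ) (N : ℕ) : Prop :=
  ∀ (m : ℕ) (r c : Fin m → ℕ), (Matrix.of fun i j : Fin m => A (r i) (c j)).rank ≤ N

/-- The matrix `𝔓(F)` with entries `𝐭_F(z^k, z^{k'})`. -/
def matP (T : Dst) : ℕ → ℕ → ℂ :=
  fun k k' => toeplitzForm T (fun z => z ^ k) (fun z => z ^ k')

/-- The matrix `𝔎(F)` attached to a sequence of points, with entries
`𝐭_F(κ_{z_k}, κ_{z_{k'}})`. -/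
def matK (T : Dst) (zs : ℕ → ℂ) : ℕ → ℕ → ℂ :=
  fun k k' => toeplitzForm T (repKer (zs k)) (repKer (zs k'))

/-- The scaling `S_t ψ (z) = t ψ(tz)`. -/
def scaleS (t : ℝ) (ψ : ℂ → ℂ) : ℂ → ℂ := fun z => (t : ℂ) * ψ ((t : ℂ) * z)

/-- The scaling `W_t` on distributions, `⟨W_t 𝐅, ψ⟩ = ⟨𝐅, S_{t⁻¹} ψ⟩`. -/
def scaleW (t : ℝ) (T : Dst) : Dst := fun ψ => T (scaleS t⁻¹ ψ)

/-- `ψ` is `C^l` and its derivatives up to order `l` are bounded by `K exp (c|z| + s|z|²)`. -/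
def DerivBound (l : ℕ) (K c s : ℝ) (ψ : ℂ → ℂ) : Prop :=
  ContDiff ℝ (l : ℕ∞) ψ ∧
    ∀ n ≤ l, ∀ z : ℂ, ‖iteratedFDeriv ℝ n ψ z‖ ≤ K * Real.exp (c * ‖z‖ + s * ‖z‖ ^ 2)

theorem DerivBound.mul {l : ℕ} {K c s K' c' s' : ℝ} {ψ φ : ℂ → ℂ} (hK : 0 ≤ K)
    (hψ : DerivBound l K c s ψ) (hφ : DerivBound l K' c' s' φ) :
    DerivBound l (2 ^ l * K * K') (c + c') (s + s') (fun z => ψ z * φ z) := by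
  refine ⟨hψ.1.mul hφ.1, fun n hn z => ?_⟩
  have hK' : 0 ≤ K' := nonneg_of_mul_nonneg_left
    ((norm_nonneg _).trans (hφ.2 0 (Nat.zero_le _) z)) (Real.exp_pos _)
  have hsplit : Real.exp ((c + c') * ‖z‖ + (s + s') * ‖z‖ ^ 2) =
      Real.exp (c * ‖z‖ + s * ‖z‖ ^ 2) * Real.exp (c' * ‖z‖ + s' * ‖z‖ ^ 2) := by
    rw [← Real.exp_add]; ring_nf
  calc ‖iteratedFDeriv ℝ n (fun z => ψ z * φ z) z‖
      ≤ ∑ i ∈ Finset.range (n + 1),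
          (n.choose i : ℝ) * ‖iteratedFDeriv ℝ i ψ z‖ * ‖iteratedFDeriv ℝ (n - i) φ z‖ :=
        norm_iteratedFDeriv_mul_le hψ.1 hφ.1 z (by exact_mod_cast hn)
    _ ≤ ∑ i ∈ Finset.range (n + 1), (n.choose i : ℝ) *
          (K * Real.exp (c * ‖z‖ + s * ‖z‖ ^ 2)) *
          (K' * Real.exp (c' * ‖z‖ + s' * ‖z‖ ^ 2)) := by
        refine Finset.sum_le_sum fun i hi => ?_
        have hi' : i ≤ n := Nat.lt_succ_iff.mp (Finset.mem_range.mp hi)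
        gcongr
        · exact hψ.2 i (hi'.trans hn) z
        · exact hφ.2 (n - i) ((Nat.sub_le _ _).trans hn) z
    _ = 2 ^ n * K * K' * Real.exp ((c + c') * ‖z‖ + (s + s') * ‖z‖ ^ 2) := by
        rw [← Finset.sum_mul, ← Finset.sum_mul, hsplit, ← Nat.cast_sum, Nat.sum_range_choose]
        push_cast
        ring
    _ ≤ _ := by
        gcongr
        norm_num

theorem DerivBound.comp_conj {l : ℕ} {K c s : ℝ} {ψ : ℂ → ℂ} (h : DerivBound l K c s ψ) :
    DerivBound l K c s (fun z => ψ ((starRingEnd ℂ) z)) := by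
  refine ⟨h.1.comp conjCLE.contDiff, fun n hn z => ?_⟩
  have := conjLIE.norm_iteratedFDeriv_comp_right (𝕜 := ℝ) ψ z n
  have h2 := h.2 n hn ((starRingEnd ℂ) z)
  rw [RCLike.norm_conj] at h2
  exact (le_of_eq this).trans h2

/-- Cauchy's estimates bound the derivatives of an entire function of exponential type. -/
theorem derivBound_of_entire (l : ℕ) {K c : ℝ} (hc : 0 ≤ c) {f : ℂ → ℂ}
    (hf : Differentiable ℂ f) (hb : ∀ z, ‖f z‖ ≤ K * Real.exp (c * ‖z‖)) :
    DerivBound l (l.factorial * (K * Real.exp c)) c 0 f := by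
  have hK : 0 ≤ K := nonneg_of_mul_nonneg_left ((norm_nonneg _).trans (hb 0)) (Real.exp_pos _)
  refine ⟨(hf.contDiff (n := (l : ℕ∞))).restrict_scalars ℝ, fun n hn z => ?_⟩
  have h1 : ‖iteratedFDeriv ℝ n f z‖ = ‖iteratedDeriv n f z‖ := by
    rw [← norm_iteratedFDeriv_eq_norm_iteratedDeriv,
      ← (hf.contDiff (n := n)).contDiffAt.restrictScalars_iteratedFDeriv (𝕜 := ℝ)]
    simp
  have h2 : ‖iteratedDeriv n f z‖ ≤
      n.factorial * (K * Real.exp (c * (‖z‖ + 1))) / 1 ^ n := by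
    refine norm_iteratedDeriv_le_of_forall_mem_sphere_norm_le n one_pos hf.diffContOnCl
      fun w hw => (hb w).trans ?_
    have : ‖w‖ ≤ ‖z‖ + 1 := by
      have := norm_le_norm_add_norm_sub' w z
      rw [mem_sphere_iff_norm.1 hw] at this
      exact this
    gcongr
  rw [h1]
  refine h2.trans ?_
  have : Real.exp (c * (‖z‖ + 1)) = Real.exp c * Real.exp (c * ‖z‖ + 0 * ‖z‖ ^ 2) := by
    rw [← Real.exp_add]; ring_nf
  rw [this, one_pow, div_one, mul_assoc, mul_assoc]
  have hfac : (n.factorial : ℝ) ≤ l.factorial := by exact_mod_cast Nat.factorial_le hn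
  gcongr

theorem lambdaNorm_nonneg (q : ℝ) (l : ℕ) (ψ : ℂ → ℂ) : 0 ≤ lambdaNorm q l ψ := by
  refine Real.sSup_nonneg ?_
  rintro r ⟨n, -, z, rfl⟩
  positivity

theorem quadratic_exponent_le {c d : ℝ} (hd : 0 < d) (t : ℝ) :
    c * t - d * t ^ 2 ≤ c ^ 2 / (4 * d) := by
  rw [le_div_iff₀ (by positivity)]
  nlinarith [sq_nonneg (c - 2 * d * t)]

theorem DerivBound.weighted_le {l : ℕ} {K c s : ℝ} {ψ : ℂ → ℂ} (h : DerivBound l K c s ψ)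
    (q : ℝ) {n : ℕ} (hn : n ≤ l) (z : ℂ) :
    ‖iteratedFDeriv ℝ n ψ z‖ * Real.exp (-q * ‖z‖ ^ 2) ≤
      K * Real.exp (c * ‖z‖ - (q - s) * ‖z‖ ^ 2) := by
  have : Real.exp (c * ‖z‖ - (q - s) * ‖z‖ ^ 2) =
      Real.exp (c * ‖z‖ + s * ‖z‖ ^ 2) * Real.exp (-q * ‖z‖ ^ 2) := by
    rw [← Real.exp_add]; ring_nf
  rw [this, ← mul_assoc]
  gcongr
  exact h.2 n hn z

theorem DerivBound.memLambda {l : ℕ} {K c s q : ℝ} {ψ : ℂ → ℂ} (h : DerivBound l K c s ψ)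
    (hs : s < q) : MemLambda q l ψ := by
  refine ⟨h.1, fun n hn => squeeze_zero (fun z => by positivity)
    (fun z => h.weighted_le q hn z) ?_⟩
  have hd : 0 < q - s := sub_pos.2 hs
  have h1 : Tendsto (fun t : ℝ => c * t - (q - s) * t ^ 2) atTop atBot := by
    have : (fun t : ℝ => c * t - (q - s) * t ^ 2) = fun t => t * (c + -(q - s) * t) := by
      ext t; ring
    rw [this]
    exact tendsto_id.atTop_mul_atBot₀ (tendsto_atBot_add_const_left _ _
      (tendsto_id.const_mul_atTop_of_neg (by linarith)))
  have h2 := (Real.tendsto_exp_atBot.comp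
    (h1.comp (tendsto_norm_cocompact_atTop (E := ℂ)))).const_mul K
  simpa using h2

theorem DerivBound.lambdaNorm_le {l : ℕ} {K c s q : ℝ} {ψ : ℂ → ℂ} (h : DerivBound l K c s ψ)
    (hK : 0 ≤ K) (hs : s < q) :
    lambdaNorm q l ψ ≤ K * Real.exp (c ^ 2 / (4 * (q - s))) := by
  refine Real.sSup_le ?_ (by positivity)
  rintro r ⟨n, hn, z, rfl⟩
  refine (h.weighted_le q hn z).trans ?_
  gcongr
  exact quadratic_exponent_le (sub_pos.2 hs) _

theorem MemLambda.derivBound {q : ℝ} {l : ℕ} {ψ : ℂ → ℂ} (h : MemLambda q l ψ) :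
    DerivBound l (lambdaNorm q l ψ) 0 q ψ := by
  refine ⟨h.1, fun n hn z => ?_⟩
  have hbdd : BddAbove {r : ℝ | ∃ n ≤ l, ∃ z : ℂ,
      r = ‖iteratedFDeriv ℝ n ψ z‖ * Real.exp (-q * ‖z‖ ^ 2)} := by
    have heq : {r : ℝ | ∃ n ≤ l, ∃ z : ℂ,
        r = ‖iteratedFDeriv ℝ n ψ z‖ * Real.exp (-q * ‖z‖ ^ 2)} =
        ⋃ n ∈ Set.Iic l, Set.range fun z : ℂ =>
          ‖iteratedFDeriv ℝ n ψ z‖ * Real.exp (-q * ‖z‖ ^ 2) := by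
      ext r
      simp [eq_comm]
    rw [heq, (Set.finite_Iic l).bddAbove_biUnion]
    intro n hn
    have hcont : Continuous fun z : ℂ =>
        ‖iteratedFDeriv ℝ n ψ z‖ * Real.exp (-q * ‖z‖ ^ 2) :=
      (h.1.continuous_iteratedFDeriv (by exact_mod_cast hn)).norm.mul (by fun_prop)
    have hev := (h.2 n hn).eventually (ge_mem_nhds one_pos)
    obtain ⟨S, hS, hSz⟩ := mem_cocompact.1 hev
    obtain ⟨B, hB⟩ := (hS.image hcont).bddAbove
    refine ⟨max 1 B, ?_⟩
    rintro _ ⟨z, rfl⟩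
    by_cases hz : z ∈ S
    · exact (hB ⟨z, hz, rfl⟩).trans (le_max_right _ _)
    · exact (show _ ≤ (1 : ℝ) from hSz hz).trans (le_max_left _ _)
  have hle : ‖iteratedFDeriv ℝ n ψ z‖ * Real.exp (-q * ‖z‖ ^ 2) ≤ lambdaNorm q l ψ :=
    le_csSup hbdd ⟨n, hn, z, rfl⟩
  have hone : Real.exp (-q * ‖z‖ ^ 2) * Real.exp (0 * ‖z‖ + q * ‖z‖ ^ 2) = 1 := by
    rw [← Real.exp_add]; simp
  calc ‖iteratedFDeriv ℝ n ψ z‖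
      = ‖iteratedFDeriv ℝ n ψ z‖ * Real.exp (-q * ‖z‖ ^ 2) *
          Real.exp (0 * ‖z‖ + q * ‖z‖ ^ 2) := by rw [mul_assoc, hone, mul_one]
    _ ≤ _ := by gcongr

theorem MemLambda.add {q : ℝ} {l : ℕ} {ψ φ : ℂ → ℂ} (hψ : MemLambda q l ψ)
    (hφ : MemLambda q l φ) : MemLambda q l (ψ + φ) := by
  refine ⟨hψ.1.add hφ.1, fun n hn => ?_⟩
  refine squeeze_zero (fun z => by positivity) (fun z => ?_)
    (add_zero (0 : ℝ) ▸ (hψ.2 n hn).add (hφ.2 n hn))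
  rw [← add_mul]
  gcongr
  have hn' : (n : WithTop ℕ∞) ≤ ((l : ℕ∞) : WithTop ℕ∞) := by exact_mod_cast hn
  rw [iteratedFDeriv_add_apply (hψ.1.of_le hn').contDiffAt (hφ.1.of_le hn').contDiffAt]
  exact norm_add_le _ _

theorem MemLambda.const_smul {q : ℝ} {l : ℕ} {ψ : ℂ → ℂ} (hψ : MemLambda q l ψ) (c : ℂ) :
    MemLambda q l (c • ψ) := by
  refine ⟨hψ.1.const_smul c, fun n hn => ?_⟩
  refine squeeze_zero (fun z => by positivity) (fun z => ?_)
    (mul_zero ‖c‖ ▸ (hψ.2 n hn).const_mul ‖c‖)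
  have hn' : (n : WithTop ℕ∞) ≤ ((l : ℕ∞) : WithTop ℕ∞) := by exact_mod_cast hn
  rw [iteratedFDeriv_const_smul_apply (hψ.1.of_le hn').contDiffAt, norm_smul, mul_assoc]

theorem MemLambda.zero (q : ℝ) (l : ℕ) : MemLambda q l 0 := by
  refine ⟨contDiff_const, fun n _ => ?_⟩
  simp [Pi.zero_def]

theorem MemLambda.sum {q : ℝ} {l : ℕ} {ι : Type*} (s : Finset ι) (c : ι → ℂ) (φ : ι → ℂ → ℂ)
    (h : ∀ i ∈ s, MemLambda q l (φ i)) : MemLambda q l (∑ i ∈ s, c i • φ i) := by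
  classical
  exact Finset.sum_induction _ _ (fun _ _ => MemLambda.add) (MemLambda.zero q l)
    fun i hi => (h i hi).const_smul (c i)

theorem MemLambdaDual.map_sum {q : ℝ} {l : ℕ} {T : Dst} (hT : MemLambdaDual q l T) {ι : Type*}
    (s : Finset ι) (c : ι → ℂ) (φ : ι → ℂ → ℂ) (h : ∀ i ∈ s, MemLambda q l (φ i)) :
    T (∑ i ∈ s, c i • φ i) = ∑ i ∈ s, c i * T (φ i) := by
  classical
  induction s using Finset.induction_on with
  | empty => simpa using hT.2.1 0 0 (MemLambda.zero q l)
  | insert i s hi ih =>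
    have hs : ∀ j ∈ s, MemLambda q l (φ j) := fun j hj => h j (Finset.mem_insert_of_mem hj)
    have hφ := h i (Finset.mem_insert_self i s)
    rw [Finset.sum_insert hi, Finset.sum_insert hi,
      hT.1 _ _ (hφ.const_smul _) (MemLambda.sum s c φ hs), hT.2.1 _ _ hφ, ih hs]

theorem MemLambdaDual.exists_norm_le {q : ℝ} {l : ℕ} {T : Dst} (hT : MemLambdaDual q l T) :
    ∃ C : ℝ, 0 ≤ C ∧ ∀ ψ, MemLambda q l ψ → ‖T ψ‖ ≤ C * lambdaNorm q l ψ := by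
  obtain ⟨C, hC⟩ := hT.2.2
  exact ⟨|C|, abs_nonneg C, fun ψ hψ => (hC ψ hψ).trans
    (mul_le_mul_of_nonneg_right (le_abs_self C) (lambdaNorm_nonneg q l ψ))⟩

/-- Every polynomial is of exponential type. -/
theorem exists_polynomial_norm_le_exp (P : Polynomial ℂ) :
    ∃ K : ℝ, ∀ z : ℂ, ‖P.eval z‖ ≤ K * Real.exp (1 * ‖z‖) := by
  induction P using Polynomial.induction_on' with
  | add P Q hP hQ =>
    obtain ⟨K, hK⟩ := hP
    obtain ⟨K', hK'⟩ := hQ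
    refine ⟨K + K', fun z => ?_⟩
    rw [Polynomial.eval_add, add_mul]
    exact (norm_add_le _ _).trans (add_le_add (hK z) (hK' z))
  | monomial n a =>
    refine ⟨‖a‖ * n.factorial, fun z => ?_⟩
    rw [Polynomial.eval_monomial, norm_mul, norm_pow, mul_assoc, one_mul]
    have := Real.pow_div_factorial_le_exp ‖z‖ (norm_nonneg z) n
    rw [div_le_iff₀ (by positivity)] at this
    gcongr
    linarith

/-- The Taylor polynomial of degree less than `M` of `z ↦ exp (z * a)`. -/
def expTaylor (a : ℂ) (M : ℕ) (z : ℂ) : ℂ :=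
  ∑ n ∈ Finset.range M, (z * a) ^ n / (n.factorial : ℂ)

theorem differentiable_expTaylor (a : ℂ) (M : ℕ) : Differentiable ℂ (expTaylor a M) := by
  unfold expTaylor
  fun_prop

theorem norm_expTaylor_le (a : ℂ) (M : ℕ) (z : ℂ) :
    ‖expTaylor a M z‖ ≤ 1 * Real.exp (‖a‖ * ‖z‖) := by
  rw [one_mul, mul_comm, ← norm_mul]
  refine (norm_sum_le _ _).trans ?_
  refine le_trans (le_of_eq ?_) (Real.sum_le_exp_of_nonneg (norm_nonneg (z * a)) M)
  exact Finset.sum_congr rfl fun n _ => by simp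

theorem exp_sub_sum_le {x : ℝ} (hx : 0 ≤ x) (M : ℕ) :
    Real.exp x - ∑ n ∈ Finset.range M, x ^ n / n.factorial ≤
      (1 / 2) ^ M * Real.exp (2 * x) := by
  have hsum (y : ℝ) : HasSum (fun n : ℕ => y ^ n / n.factorial) (Real.exp y) := by
    rw [Real.exp_eq_exp_ℝ]
    exact NormedSpace.expSeries_div_hasSum_exp y
  have htail (y : ℝ) := (hasSum_nat_add_iff' M).2 (hsum y)
  refine (hasSum_le (fun n => ?_) (htail x) ((htail (2 * x)).mul_left ((1 / 2) ^ M))).trans ?_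
  · rw [mul_pow, pow_add 2, mul_div_assoc, mul_assoc, mul_left_comm, ← mul_assoc,
      ← mul_assoc, mul_assoc (2 ^ n : ℝ), ← mul_pow]
    have : (1 : ℝ) ≤ 2 ^ n := one_le_pow₀ one_le_two
    have h0 : 0 ≤ x ^ (n + M) / ((n + M).factorial : ℝ) := by positivity
    norm_num
    nlinarith
  · gcongr
    have : 0 ≤ ∑ n ∈ Finset.range M, (2 * x) ^ n / (n.factorial : ℝ) := by positivity
    linarith

theorem norm_exp_sub_expTaylor_le (a : ℂ) (M : ℕ) (z : ℂ) :
    ‖Complex.exp (z * a) - expTaylor a M z‖ ≤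
      (1 / 2) ^ M * Real.exp (2 * ‖a‖ * ‖z‖) := by
  refine (Complex.norm_exp_sub_sum_le_exp_norm_sub_sum (z * a) M).trans ?_
  refine (exp_sub_sum_le (norm_nonneg _) M).trans (le_of_eq ?_)
  rw [norm_mul]
  ring_nf

theorem norm_exp_mul_le (a z : ℂ) : ‖Complex.exp (z * a)‖ ≤ 1 * Real.exp (‖a‖ * ‖z‖) := by
  rw [one_mul, mul_comm, ← norm_mul, mul_comm]
  exact Complex.norm_exp_le_exp_norm _

theorem InfRankLE.rank_le {A : ℕ → ℕ → ℂ} {N : ℕ} (h : InfRankLE A N) {ι κ : Type*}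
    [Fintype ι] [Fintype κ] (r : ι → ℕ) (c : κ → ℕ) :
    (Matrix.of fun i j => A (r i) (c j)).rank ≤ N := by
  let e := Fintype.equivFin (ι ⊕ κ)
  have := (Matrix.of fun i j => A (Sum.elim r (fun _ => 0) (e.symm i))
    (Sum.elim (fun _ => 0) c (e.symm j))).rank_submatrix_le
      (fun i : ι => e (Sum.inl i)) (fun j : κ => e (Sum.inr j))
  refine le_trans (le_of_eq ?_) (this.trans (h _ _ _))
  congr 1
  ext i j
  simp

theorem rank_le_of_tendsto {m : ℕ} {N : ℕ} {A : ℕ → Matrix (Fin m) (Fin m) ℂ}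
    {B : Matrix (Fin m) (Fin m) ℂ} (hA : ∀ M, (A M).rank ≤ N)
    (hlim : Tendsto A atTop (nhds B)) : B.rank ≤ N := by
  by_contra! hlt
  let L : Matrix (Fin m) (Fin m) ℂ →ₗ[ℂ] ((Fin m → ℂ) →L[ℂ] (Fin m → ℂ)) :=
    LinearMap.toContinuousLinearMap.toLinearMap ∘ₗ Matrix.toLin'.toLinearMap
  have hL : Continuous L := L.continuous_of_finiteDimensional
  have hrank (X : Matrix (Fin m) (Fin m) ℂ) :
      LinearMap.rank (L X : (Fin m → ℂ) →ₗ[ℂ] (Fin m → ℂ)) =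
        (X.rank : Cardinal) := by
    rw [Matrix.rank, Module.finrank_eq_rank]
    rfl
  have hopen := (isOpen_setOfPred_nat_le_rank (𝕜 := ℂ) (E := Fin m → ℂ) (F := Fin m → ℂ)
    (N + 1)).preimage hL
  have hB : ((N + 1 : ℕ) : Cardinal) ≤
      LinearMap.rank (L B : (Fin m → ℂ) →ₗ[ℂ] (Fin m → ℂ)) := by
    rw [hrank]
    exact_mod_cast hlt
  obtain ⟨M, hM⟩ := (hlim.eventually (hopen.mem_nhds hB)).exists
  have hM' : ((N + 1 : ℕ) : Cardinal) ≤
      LinearMap.rank (L (A M) : (Fin m → ℂ) →ₗ[ℂ] (Fin m → ℂ)) := hM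
  rw [hrank] at hM'
  have : N + 1 ≤ (A M).rank := by exact_mod_cast hM'
  exact absurd (hA M) (by omega)

theorem derivBound_entire_mul_conj (l : ℕ) {K c K' c' : ℝ} (hc : 0 ≤ c) (hc' : 0 ≤ c')
    {f g : ℂ → ℂ} (hf : Differentiable ℂ f) (hg : Differentiable ℂ g)
    (hfb : ∀ z, ‖f z‖ ≤ K * Real.exp (c * ‖z‖))
    (hgb : ∀ z, ‖g z‖ ≤ K' * Real.exp (c' * ‖z‖)) :
    DerivBound l (2 ^ l * (l.factorial * (K * Real.exp c)) *
      (l.factorial * (K' * Real.exp c'))) (c + c') 0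
      (fun z => f z * g ((starRingEnd ℂ) z)) := by
  have hK : 0 ≤ K := nonneg_of_mul_nonneg_left ((norm_nonneg _).trans (hfb 0)) (Real.exp_pos _)
  have := (derivBound_of_entire l hc hf hfb).mul (by positivity)
    (derivBound_of_entire l hc' hg hgb).comp_conj
  rwa [add_zero] at this

/-- A functional in `Λ'_{q,l}` is bounded on products `f(z) g(z̄)` with `f`, `g` entire of
exponential type. -/
theorem MemLambdaDual.exists_norm_entire_mul_conj_le {q : ℝ} (hq : 0 < q) {l : ℕ} {T : Dst}
    (hT : MemLambdaDual q l T) {c c' : ℝ} (hc : 0 ≤ c) (hc' : 0 ≤ c') :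
    ∃ C : ℝ, ∀ (K K' : ℝ) (f g : ℂ → ℂ), Differentiable ℂ f → Differentiable ℂ g →
      (∀ z, ‖f z‖ ≤ K * Real.exp (c * ‖z‖)) → (∀ z, ‖g z‖ ≤ K' * Real.exp (c' * ‖z‖)) →
      ‖T fun z => f z * g ((starRingEnd ℂ) z)‖ ≤ C * (K * K') := by
  obtain ⟨C, hC0, hC⟩ := hT.exists_norm_le
  refine ⟨C * (2 ^ l * (l.factorial * Real.exp c) * (l.factorial * Real.exp c') *
    Real.exp ((c + c') ^ 2 / (4 * (q - 0)))), fun K K' f g hf hg hfb hgb => ?_⟩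
  have hK : 0 ≤ K := nonneg_of_mul_nonneg_left ((norm_nonneg _).trans (hfb 0)) (Real.exp_pos _)
  have hK' : 0 ≤ K' := nonneg_of_mul_nonneg_left ((norm_nonneg _).trans (hgb 0)) (Real.exp_pos _)
  have h := derivBound_entire_mul_conj l hc hc' hf hg hfb hgb
  refine (hC _ (h.memLambda hq)).trans ?_
  refine (mul_le_mul_of_nonneg_left (h.lambdaNorm_le (by positivity) hq) hC0).trans
    (le_of_eq ?_)
  ring

theorem MemLambdaDual.conj_polynomial_mul {q q' : ℝ} (hqq : q' < q) {l : ℕ} {T : Dst}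
    (hT : MemLambdaDual q l T) (P : Polynomial ℂ) :
    MemLambdaDual q' l (fun ψ => T fun z => P.eval ((starRingEnd ℂ) z) * ψ z) := by
  obtain ⟨C, hC0, hC⟩ := hT.exists_norm_le
  obtain ⟨K, hK⟩ := exists_polynomial_norm_le_exp P
  have hK0 : 0 ≤ K := nonneg_of_mul_nonneg_left ((norm_nonneg _).trans (hK 0)) (Real.exp_pos _)
  have hb (ψ : ℂ → ℂ) (hψ : MemLambda q' l ψ) :=
    ((derivBound_of_entire l zero_le_one P.differentiable hK).comp_conj).mul (by positivity)
      hψ.derivBound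
  have hmem (ψ : ℂ → ℂ) (hψ : MemLambda q' l ψ) := (hb ψ hψ).memLambda (q := q) (by linarith)
  refine ⟨fun ψ φ hψ hφ => ?_, fun c ψ hψ => ?_, ?_⟩
  · rw [← hT.1 _ _ (hmem ψ hψ) (hmem φ hφ)]
    refine congrArg T (funext fun z => ?_)
    simp [mul_add]
  · rw [← hT.2.1 _ _ (hmem ψ hψ)]
    refine congrArg T (funext fun z => ?_)
    simp [mul_left_comm]
  · refine ⟨C * (2 ^ l * (l.factorial * (K * Real.exp 1)) *
      Real.exp ((1 + 0) ^ 2 / (4 * (q - (0 + q'))))), fun ψ hψ => ?_⟩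
    have h0 := lambdaNorm_nonneg q' l ψ
    refine (hC _ (hmem ψ hψ)).trans ?_
    refine (mul_le_mul_of_nonneg_left ((hb ψ hψ).lambdaNorm_le (by positivity)
      (by linarith)) hC0).trans (le_of_eq ?_)
    ring

theorem memLambda_polynomial_mul_conj {q : ℝ} (hq : 0 < q) (l : ℕ) (P Q : Polynomial ℂ) :
    MemLambda q l (fun z => P.eval z * Q.eval ((starRingEnd ℂ) z)) := by
  obtain ⟨K, hK⟩ := exists_polynomial_norm_le_exp P
  obtain ⟨K', hK'⟩ := exists_polynomial_norm_le_exp Q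
  exact (derivBound_entire_mul_conj l zero_le_one zero_le_one P.differentiable
    Q.differentiable hK hK').memLambda hq

theorem MemLambdaDual.infRankLE_matP_conj_polynomial_mul {q : ℝ} (hq : 0 < q) {l N : ℕ}
    {T : Dst} (hT : MemLambdaDual q l T) (P : Polynomial ℂ) (hP : InfRankLE (matP T) N) :
    InfRankLE (matP (fun ψ => T fun z => P.eval ((starRingEnd ℂ) z) * ψ z)) N := by
  intro m r c
  let K : ℕ := (Finset.univ.sup fun j => (P * Polynomial.X ^ c j).natDegree) + 1
  have hfactor : (Matrix.of fun i j : Fin m =>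
      matP (fun ψ => T fun z => P.eval ((starRingEnd ℂ) z) * ψ z) (r i) (c j)) =
      (Matrix.of fun (i : Fin m) (x : Fin K) => matP T (r i) x) *
        (Matrix.of fun (x : Fin K) (j : Fin m) => (P * Polynomial.X ^ c j).coeff x) := by
    ext i j
    have hdeg : (P * Polynomial.X ^ c j).natDegree < K :=
      Nat.lt_succ_of_le (Finset.le_sup (f := fun j => (P * Polynomial.X ^ c j).natDegree)
        (Finset.mem_univ j))
    have hmem (x : ℕ) : MemLambda q l fun z => z ^ r i * (starRingEnd ℂ) (z ^ x) := by
      simpa using memLambda_polynomial_mul_conj hq l (Polynomial.X ^ r i) (Polynomial.X ^ x)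
    have hsum := hT.map_sum (Finset.range K) (fun x => (P * Polynomial.X ^ c j).coeff x)
      (fun x z => z ^ r i * (starRingEnd ℂ) (z ^ x)) fun x _ => hmem x
    simp only [Matrix.mul_apply, Matrix.of_apply]
    refine Eq.trans ?_ (Fin.sum_univ_eq_sum_range
      (fun x => matP T (r i) x * (P * Polynomial.X ^ c j).coeff x) K).symm
    simp only [matP, toeplitzForm]
    simp_rw [mul_comm (T _)]
    rw [← hsum]
    refine congrArg T (funext fun z => ?_)
    have hev := Polynomial.eval_eq_sum_range' hdeg ((starRingEnd ℂ) z)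
    rw [Polynomial.eval_mul, Polynomial.eval_pow, Polynomial.eval_X] at hev
    simp only [Finset.sum_apply, Pi.smul_apply, smul_eq_mul, map_pow]
    rw [mul_left_comm, hev, Finset.mul_sum]
    exact Finset.sum_congr rfl fun x _ => by ring
  rw [hfactor]
  exact (Matrix.rank_mul_le_left _ _).trans (hP.rank_le r fun x : Fin K => (x : ℕ))

theorem MemLambdaDual.tendsto_expTaylor {q : ℝ} (hq : 0 < q) {l : ℕ} {T : Dst}
    (hT : MemLambdaDual q l T) (P : Polynomial ℂ) (a b : ℂ) :
    Tendsto (fun M : ℕ => T fun z => expTaylor a M z *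
        (P.eval ((starRingEnd ℂ) z) * expTaylor b M ((starRingEnd ℂ) z))) atTop
      (nhds (T fun z => Complex.exp (z * a) *
        (P.eval ((starRingEnd ℂ) z) * Complex.exp ((starRingEnd ℂ) z * b)))) := by
  obtain ⟨K, hK⟩ := exists_polynomial_norm_le_exp P
  have hmul {B d : ℝ} {g : ℂ → ℂ} (hg : ∀ z, ‖g z‖ ≤ B * Real.exp (d * ‖z‖)) (z : ℂ) :
      ‖P.eval z * g z‖ ≤ (K * B) * Real.exp ((1 + d) * ‖z‖) := by
    have : Real.exp ((1 + d) * ‖z‖) = Real.exp (1 * ‖z‖) * Real.exp (d * ‖z‖) := by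
      rw [← Real.exp_add]; ring_nf
    rw [norm_mul, this, mul_mul_mul_comm]
    exact mul_le_mul (hK z) (hg z) (norm_nonneg _) ((norm_nonneg _).trans (hK z))
  have hexp (a : ℂ) : Differentiable ℂ fun z => Complex.exp (z * a) := by fun_prop
  have hrem (a : ℂ) (M : ℕ) :
      Differentiable ℂ fun z => Complex.exp (z * a) - expTaylor a M z :=
    (hexp a).sub (differentiable_expTaylor a M)
  have h2a : 0 ≤ 2 * ‖a‖ := by positivity
  have h1b : 0 ≤ 1 + ‖b‖ := by positivity
  have h2b : 0 ≤ 1 + 2 * ‖b‖ := by positivity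
  obtain ⟨C₁, hC₁⟩ := hT.exists_norm_entire_mul_conj_le hq h2a h1b
  obtain ⟨C₂, hC₂⟩ := hT.exists_norm_entire_mul_conj_le hq (norm_nonneg a) h2b
  have hPe := P.differentiable.mul (hexp b)
  have hPr (M : ℕ) := P.differentiable.mul (hrem b M)
  rw [tendsto_iff_norm_sub_tendsto_zero]
  have hlim : Tendsto (fun M : ℕ => C₁ * ((1 / 2 : ℝ) ^ M * (K * 1)) +
      C₂ * (1 * (K * (1 / 2 : ℝ) ^ M))) atTop (nhds 0) := by
    have h := tendsto_pow_atTop_nhds_zero_of_lt_one (r := (1 / 2 : ℝ)) (by norm_num)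
      (by norm_num)
    simpa using ((h.mul_const (K * 1)).const_mul C₁).add
      (((h.const_mul K).const_mul 1).const_mul C₂)
  refine squeeze_zero (fun _ => norm_nonneg _) (fun M => ?_) hlim
  have hm₁ := (derivBound_entire_mul_conj l h2a h1b (hrem a M) hPe
    (norm_exp_sub_expTaylor_le a M) (hmul (norm_exp_mul_le b))).memLambda hq
  have hm₂ := (derivBound_entire_mul_conj l (norm_nonneg a) h2b (differentiable_expTaylor a M)
    (hPr M) (norm_expTaylor_le a M) (hmul (norm_exp_sub_expTaylor_le b M))).memLambda hq
  have hm₃ := (derivBound_entire_mul_conj l (norm_nonneg a) (by positivity : 0 ≤ 1 + ‖b‖)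
    (differentiable_expTaylor a M) (P.differentiable.mul (differentiable_expTaylor b M))
    (norm_expTaylor_le a M) (hmul (norm_expTaylor_le b M))).memLambda hq
  have hsplit := hT.1 _ _ (hm₁.add hm₂) hm₃
  rw [hT.1 _ _ hm₁ hm₂] at hsplit
  rw [norm_sub_rev]
  refine (congrArg norm (sub_eq_of_eq_add
    (Eq.trans (congrArg T (funext fun z => ?_)) hsplit))).trans_le ?_
  · simp only [Pi.add_apply, Pi.mul_apply]
    ring
  · exact (norm_add_le _ _).trans (add_le_add
      (hC₁ _ _ _ _ (hrem a M) hPe (norm_exp_sub_expTaylor_le a M) (hmul (norm_exp_mul_le b)))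
      (hC₂ _ _ _ _ (differentiable_expTaylor a M) (hPr M) (norm_expTaylor_le a M)
        (hmul (norm_exp_sub_expTaylor_le b M))))

theorem MemLambdaDual.infRankLE_matK_conj_polynomial_mul {q : ℝ} (hq : 0 < q) {l N : ℕ}
    {T : Dst} (hT : MemLambdaDual q l T) (P : Polynomial ℂ)
    (hP : InfRankLE (matP (fun ψ => T fun z => P.eval ((starRingEnd ℂ) z) * ψ z)) N)
    (zs : ℕ → ℂ) :
    InfRankLE (matK (fun ψ => T fun z => P.eval ((starRingEnd ℂ) z) * ψ z) zs) N := by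
  intro m r c
  let G : Dst := fun ψ => T fun z => P.eval ((starRingEnd ℂ) z) * ψ z
  let coef (w : ℂ) (n : ℕ) : ℂ := w ^ n / n.factorial
  let A (M : ℕ) : Matrix (Fin m) (Fin m) ℂ :=
    (Matrix.of fun (i : Fin m) (n : Fin M) => coef ((starRingEnd ℂ) (zs (r i))) n) *
      ((Matrix.of fun n k : Fin M => matP G n k) *
        (Matrix.of fun (k : Fin M) (j : Fin m) => coef (zs (c j)) k))
  refine rank_le_of_tendsto (A := A) (fun M => ?_) ?_
  · exact (Matrix.rank_mul_le_right _ _).trans ((Matrix.rank_mul_le_left _ _).trans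
      (hP.rank_le (fun n : Fin M => (n : ℕ)) fun k : Fin M => (k : ℕ)))
  refine tendsto_pi_nhds.2 fun i => tendsto_pi_nhds.2 fun j => ?_
  have hlim := hT.tendsto_expTaylor hq P ((starRingEnd ℂ) (zs (r i))) (zs (c j))
  have hentry : (Matrix.of fun i j : Fin m => matK G zs (r i) (c j)) i j =
      T fun z => Complex.exp (z * (starRingEnd ℂ) (zs (r i))) *
        (P.eval ((starRingEnd ℂ) z) * Complex.exp ((starRingEnd ℂ) z * zs (c j))) := by
    refine congrArg T (funext fun z => ?_)
    simp only [repKer, ← Complex.exp_conj, map_mul, Complex.conj_conj]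
    ring
  change Tendsto _ _ (nhds ((Matrix.of fun i j : Fin m => matK G zs (r i) (c j)) i j))
  rw [hentry]
  refine hlim.congr fun M => ?_
  have hmem (n k : ℕ) : MemLambda q l fun z =>
      P.eval ((starRingEnd ℂ) z) * (z ^ n * (starRingEnd ℂ) (z ^ k)) := by
    have h := memLambda_polynomial_mul_conj hq l (Polynomial.X ^ n) (P * Polynomial.X ^ k)
    simp only [Polynomial.eval_mul, Polynomial.eval_pow, Polynomial.eval_X] at h
    simpa only [map_pow, mul_left_comm] using h
  have hsum := hT.map_sum (Finset.range M ×ˢ Finset.range M)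
    (fun x => coef ((starRingEnd ℂ) (zs (r i))) x.1 * coef (zs (c j)) x.2)
    (fun x z => P.eval ((starRingEnd ℂ) z) * (z ^ x.1 * (starRingEnd ℂ) (z ^ x.2)))
    fun x _ => hmem x.1 x.2
  have hA : A M i j = ∑ x ∈ Finset.range M ×ˢ Finset.range M,
      (coef ((starRingEnd ℂ) (zs (r i))) x.1 * coef (zs (c j)) x.2) * matP G x.1 x.2 := by
    rw [Finset.sum_product]
    simp only [A, Matrix.mul_apply, Matrix.of_apply]
    rw [Fin.sum_univ_eq_sum_range (fun n => coef ((starRingEnd ℂ) (zs (r i))) n *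
      ∑ k : Fin M, matP G n k * coef (zs (c j)) k) M]
    refine Finset.sum_congr rfl fun n _ => ?_
    rw [Fin.sum_univ_eq_sum_range (fun k => matP G n k * coef (zs (c j)) k) M,
      Finset.mul_sum]
    exact Finset.sum_congr rfl fun k _ => by ring
  rw [hA]
  refine Eq.trans (congrArg T (funext fun z => ?_)) hsum
  simp only [expTaylor, coef, Finset.sum_apply, Pi.smul_apply, smul_eq_mul, map_pow]
  rw [mul_left_comm, Finset.sum_mul_sum, ← Finset.sum_product', Finset.mul_sum]
  exact Finset.sum_congr rfl fun x _ => by ring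

/-- **Multiplication by an anti-analytic polynomial.** If `𝐅 ∈ Λ'_{q,l}` (`q > 1`)
and the matrices `𝔓(F)`, `𝔎(F)` have rank at most `N`, then `𝐆 = p(z̄)𝐅` belongs to
`Λ'_{q',l}` for every `q' < q` and the matrices `𝔓(G)`, `𝔎(G)` also have rank at
most `N`. -/
theorem antianalytic_polynomial_multiplication
    (q : ℝ) (hq : 1 < q) (l N : ℕ) (T : Dst) (hT : MemLambdaDual q l T)
    (P : Polynomial ℂ)
    (hP : InfRankLE (matP T) N) (hK : ∀ zs : ℕ → ℂ, InfRankLE (matK T zs) N) :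
    (∀ q' : ℝ, 0 < q' → q' < q →
        MemLambdaDual q' l
          (fun ψ => T fun z => Polynomial.eval ((starRingEnd ℂ) z) P * ψ z)) ∧
    InfRankLE
      (matP (fun ψ => T fun z => Polynomial.eval ((starRingEnd ℂ) z) P * ψ z)) N ∧
    ∀ zs : ℕ → ℂ, InfRankLE
      (matK (fun ψ => T fun z => Polynomial.eval ((starRingEnd ℂ) z) P * ψ z) zs) N := by
  have hq0 : 0 < q := one_pos.trans hq
  have hG := hT.infRankLE_matP_conj_polynomial_mul hq0 P hP
  exact ⟨fun q' _ hqq => hT.conj_polynomial_mul hqq P, hG,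
    fun zs => hT.infRankLE_matK_conj_polynomial_mul hq0 P hG zs⟩
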